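/- Let p be an odd prime, F̄ₚ an algebraic closure of 𝔽ₚ, and H ⊆ GL₂(F̄ₚ) a finite subgroup acting absolutely irreducibly on F̄ₚ². Suppose p divides the order of H. Then H contains a conjugate of SL₂(𝔽ₚ); in particular H contains the scalar matrix −1. -/

import Mathlib

open Matrix
section
open MulAction

lemma numLemma (n q k z N s r m d : ℤ) (hz : 0 < z) (hq : 3 ≤ q) (hr : 1 ≤ r) (hn : n = 1 + r * q)
    (hN : N = n * (z * q * k)) (hk1 : 1 ≤ k) (hk : k ≤ q - 1) (hm : m = z * d)
    (hs : s * m = N) (hzm : z * s = 2 * z + z * n * (q - 2)) :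
    r = 1 ∨ (q = 3 ∧ k = 2 ∧ m = 5 * z) := by
  have hs' : s = q * (1 + r * (q - 2)) := by
    have : s = 2 + n * (q - 2) := by
      apply mul_left_cancel₀ hz.ne'
      rw [hzm]; ring
    rw [this, hn]; ring
  have hq0 : q ≠ 0 := by omega
  have h1 : (1 + r * (q - 2)) * d = n * k := by
    apply mul_left_cancel₀ (mul_ne_zero hz.ne' hq0)
    have := hs.trans hN
    rw [hs', hm] at this
    linarith
  have h2 : (1 + r * (q - 2)) ∣ r * (2 * k) := by
    refine ⟨d - k, ?_⟩
    rw [mul_sub, h1, hn]; ring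
  have hco : IsCoprime (1 + r * (q - 2)) r := ⟨1, -(q - 2), by ring⟩
  obtain ⟨e, he⟩ := hco.dvd_of_dvd_mul_left h2
  by_cases hr1 : r = 1
  · exact Or.inl hr1
  right
  have hr2 : 2 ≤ r := by omega
  have hD : 0 < 1 + r * (q - 2) := by nlinarith
  have he1 : 1 ≤ e := by
    by_contra h
    have : e ≤ 0 := by omega
    nlinarith
  have he2 : e = 1 := by
    by_contra h
    have : 2 ≤ e := by omega
    nlinarith
  rw [he2, mul_one] at he
  have hr2' : r ≠ 2 := by
    rintro rfl
    omega
  have hr3 : 3 ≤ r := by omega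
  have hq3 : q = 3 := by nlinarith
  subst hq3
  have hk2 : k = 2 := by omega
  subst hk2
  have : r = 3 := by omega
  subst this
  have : d = 5 := by omega
  subst this
  exact ⟨rfl, rfl, by rw [hm]; ring⟩

lemma card_orb_stab {G X : Type*} [Group G] [MulAction G X] (x : X) :
    Nat.card (orbit G x) * Nat.card (stabilizer G x) = Nat.card G := by
  rw [← Subgroup.index_mul_card (stabilizer G x), index_stabilizer]; rfl

section
variable {G X : Type*} [Group G] [Finite G] [MulAction G X] 

lemma root_orbit (p : ℕ) [Fact p.Prime] (P : Set G) (hP1 : ∀ g ∈ P, ∃ x : X, fixedBy X g = {x})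
    (hPp : ∀ g ∈ P, ∃ u ∈ P, u ^ p = 1 ∧ ∀ x : X, g • x = x → u • x = x)
    (x y : X) (hx : ∃ g ∈ P, g • x = x) (hy : ∃ g ∈ P, g • y = y) : y ∈ orbit G x := by
  have key : ∀ x y : X, (∃ g ∈ P, g • x = x) →
      (x ∉ orbit G y → Nat.card (orbit G y) ≡ 0 [MOD p]) ∧
      (x ∈ orbit G y → Nat.card (orbit G y) ≡ 1 [MOD p]) := by
    rintro x y ⟨g, hg, hgx⟩
    obtain ⟨u, hu, hup, hux⟩ := hPp g hg
    replace hux := hux x hgx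
    have hpg : IsPGroup p (Subgroup.zpowers u) := by
      apply IsPGroup.of_card (n := (Nat.card (Subgroup.zpowers u)).factorization p)
      have h1 : Nat.card (Subgroup.zpowers u) ∣ p := by
        rw [Nat.card_zpowers]; exact orderOf_dvd_of_pow_eq_one hup
      rcases (Nat.dvd_prime (Fact.out : p.Prime)).1 h1 with h | h
      · rw [h]; simp
      · rw [h]; simp [(Fact.out : p.Prime).factorization_self]
    have hfin : Finite (orbit G y) := by
      have : Finite (Set.range fun m : G => m • y) := Set.finite_range _
      exact this
    have h := hpg.card_modEq_card_fixedPoints (orbit G y)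
    obtain ⟨x', hx'⟩ := hP1 u hu
    have hxx : x = x' := by
      have : x ∈ fixedBy X u := hux
      rw [hx'] at this; exact this
    subst hxx
    have hfix : ∀ w : orbit G y, w ∈ fixedPoints (Subgroup.zpowers u) (orbit G y) ↔ (w : X) = x := by
      intro w
      constructor
      · intro hw
        have := hw ⟨u, Subgroup.mem_zpowers u⟩
        have h2 : (w : X) ∈ fixedBy X u := congrArg Subtype.val this
        rw [hx'] at h2; exact h2
      · rintro hw ⟨v, hv⟩
        have hs : Subgroup.zpowers u ≤ stabilizer G x := by
          rw [Subgroup.zpowers_le]; exact hux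
        apply Subtype.ext
        show v • (w : X) = w
        rw [hw]; exact hs hv
    constructor
    · intro hn
      have : fixedPoints (Subgroup.zpowers u) (orbit G y) = ∅ := by
        ext w
        rw [hfix]
        simp only [Set.mem_empty_iff_false, iff_false]
        intro h; exact hn (h ▸ w.2)
      rw [this] at h
      simpa using h
    · intro hn
      have : fixedPoints (Subgroup.zpowers u) (orbit G y) = {⟨x, hn⟩} := by
        ext w
        rw [hfix]
        simp [Subtype.ext_iff]
      rw [this] at h
      simpa using h
  by_contra hcon
  have h1 := (key y x hy).1 hcon
  have h2 := (key x x hx).2 (mem_orbit_self x)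
  have h3 := h1.symm.trans h2
  have := (Fact.out : p.Prime).one_lt
  rw [Nat.ModEq, Nat.mod_eq_of_lt this] at h3
  simp at h3

/-- free action of U on the other root points -/
lemma free_card (x0 : X) (P : Set G) (hP1 : ∀ g ∈ P, ∃ x : X, fixedBy X g = {x}) (U : Subgroup G)
    (hU : ∀ u ∈ U, u • x0 = x0) (hU1 : ∀ u ∈ U, u ≠ 1 → u ∈ P) (hne : ∃ g : G, g • x0 ≠ x0) :
    ∃ r : ℕ, 1 ≤ r ∧ Nat.card (orbit G x0) = 1 + r * Nat.card U ∧
    (r = 1 → ∀ y ∈ orbit G x0, y ≠ x0 → ∀ y' ∈ orbit G x0, y' ≠ x0 → ∃ u ∈ U, u • y = y') := by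
  let Y : SubMulAction U X :=
    { carrier := {y | y ∈ orbit G x0 ∧ y ≠ x0}
      smul_mem' := by
        rintro ⟨u, hu⟩ y ⟨hy, hy'⟩
        refine ⟨?_, ?_⟩
        · show u • y ∈ _
          obtain ⟨g, rfl⟩ := hy
          exact ⟨u * g, mul_smul _ _ _⟩
        · intro h
          apply hy'
          have h1 : u • y = u • x0 := by rw [hU u hu]; exact h
          exact MulAction.injective u h1 }
  have hfin : Finite (orbit G x0) := by
    have : Finite (Set.range fun m : G => m • x0) := Set.finite_range _
    exact this
  have hYfin : Finite Y := by
    apply Set.Finite.subset (s := orbit G x0) (Set.toFinite _)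
    intro y hy; exact hy.1
  have hst : ∀ b : Y, stabilizer U b = ⊥ := by
    intro b
    rw [eq_bot_iff]
    rintro ⟨u, hu⟩ hub
    rw [Subgroup.mem_bot]
    by_contra h1
    have hu1 : u ≠ 1 := fun h => h1 (Subtype.ext h)
    obtain ⟨x, hx⟩ := hP1 u (hU1 u hu hu1)
    have e1 : x0 ∈ fixedBy X u := hU u hu
    have e2 : (b : X) ∈ fixedBy X u := congrArg Subtype.val (show (⟨u, hu⟩ : U) • b = b from hub)
    rw [hx] at e1 e2
    exact b.2.2 (e2.trans e1.symm)
  have hY : Nat.card Y = Nat.card (Quotient (orbitRel U Y)) * Nat.card U := by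
    rw [Nat.card_congr (selfEquivOrbitsQuotientProd hst), Nat.card_prod]
  have hO : Nat.card (orbit G x0) = 1 + Nat.card Y := by
    have h1 : (orbit G x0 \ {x0}).ncard + 1 = (orbit G x0).ncard :=
      Set.ncard_sdiff_singleton_add_one (mem_orbit_self x0)
    have : (orbit G x0 \ {x0}).ncard = Nat.card Y := rfl
    rw [Nat.card_coe_set_eq, ← h1, this, add_comm]
  refine ⟨Nat.card (Quotient (orbitRel U Y)), ?_, by rw [hO, hY], ?_⟩
  · obtain ⟨g, hg⟩ := hne
    have : Nonempty (Quotient (orbitRel U Y)) := ⟨Quotient.mk'' ⟨g • x0, mem_orbit _ _, hg⟩⟩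
    exact Nat.card_pos
  · intro h1 y hy hy0 y' hy' hy0'
    have hs : Subsingleton (Quotient (orbitRel U Y)) := (Nat.card_eq_one_iff_unique.1 h1).1
    have := hs.elim (Quotient.mk'' ⟨y', hy', hy0'⟩) (Quotient.mk'' ⟨y, hy, hy0⟩)
    have h2 := Quotient.exact' this
    obtain ⟨⟨u, hu⟩, h3⟩ := h2
    exact ⟨u, hu, congrArg Subtype.val h3⟩
end

section
variable {G X : Type*} [Group G] [Finite G] [MulAction G X]

open Classical in
lemma dcount (Z : Subgroup G) (P : Set G) (hPZ : ∀ g ∈ P, g ∉ Z)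
    (hZ : ∀ g ∈ Z, ∀ x : X, g • x = x) (hP1 : ∀ g ∈ P, ∃ x : X, fixedBy X g = {x})
    (hP2 : ∀ g, g ∉ P → g ∉ Z → (fixedBy X g).ncard = 2) :
    ∃ E : Finset X, (∀ x, x ∈ E ↔ ∃ g, g ∉ Z ∧ g • x = x) ∧
      (∑ x ∈ E, ((Nat.card (stabilizer G x) : ℤ) - Nat.card Z)) + Nat.card P =
        2 * ((Nat.card G : ℤ) - Nat.card Z) := by
  have : Fintype G := Fintype.ofFinite G
  have hff : ∀ g, g ∉ Z → (fixedBy X g).Finite := by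
    intro g hg
    by_cases h : g ∈ P
    · obtain ⟨x, hx⟩ := hP1 g h
      rw [hx]; exact Set.finite_singleton x
    · apply Set.finite_of_ncard_ne_zero
      rw [hP2 g h hg]; norm_num
  have hEf : {x : X | ∃ g, g ∉ Z ∧ g • x = x}.Finite := by
    have : {x : X | ∃ g, g ∉ Z ∧ g • x = x} = ⋃ g ∈ {g : G | g ∉ Z}, fixedBy X g := by
      ext x; simp
    rw [this]
    apply Set.Finite.biUnion (Set.toFinite _)
    intro g hg; exact hff g hg
  have hE : ∀ x, x ∈ hEf.toFinset ↔ ∃ g, g ∉ Z ∧ g • x = x := by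
    intro x; simp
  refine ⟨hEf.toFinset, hE, ?_⟩
  set E := hEf.toFinset with hEdef
  let s : Finset G := Finset.univ.filter (fun g => g ∉ Z)
  have hdc := Finset.sum_card_bipartiteAbove_eq_sum_card_bipartiteBelow
    (fun (g : G) (x : X) => g • x = x) (s := s) (t := E)
  have hleft : ∀ g ∈ s, ((E.bipartiteAbove (fun (g : G) (x : X) => g • x = x) g).card : ℤ)
      = 2 - if g ∈ P then 1 else 0 := by
    intro g hg
    have hgZ : g ∉ Z := by simpa [s] using hg
    have h1 : ((E.bipartiteAbove (fun (g : G) (x : X) => g • x = x) g : Finset X) : Set X)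
        = fixedBy X g := by
      ext x
      simp only [Finset.bipartiteAbove, Finset.coe_filter, Set.mem_ofPred_eq, mem_fixedBy, hE]
      exact ⟨fun h => h.2, fun h => ⟨⟨g, hgZ, h⟩, h⟩⟩
    rw [← Set.ncard_coe_finset, h1]
    split_ifs with h
    · obtain ⟨x, hx⟩ := hP1 g h
      rw [hx]; simp
    · rw [hP2 g h hgZ]; simp
  have hright : ∀ x ∈ E, ((s.bipartiteBelow (fun (g : G) (x : X) => g • x = x) x).card : ℤ)
      = (Nat.card (stabilizer G x) : ℤ) - Nat.card Z := by
    intro x _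
    have h1 : (s.bipartiteBelow (fun (g : G) (x : X) => g • x = x) x)
        = (Finset.univ.filter (fun g : G => g ∈ stabilizer G x)) \
          (Finset.univ.filter (fun g : G => g ∈ Z)) := by
      ext g
      simp only [Finset.bipartiteBelow, s, Finset.mem_filter, Finset.mem_univ, true_and,
        Finset.mem_sdiff, mem_stabilizer_iff]
      tauto
    have hsub : (Finset.univ.filter (fun g : G => g ∈ Z)) ⊆
        (Finset.univ.filter (fun g : G => g ∈ stabilizer G x)) := by
      intro g hg
      simp only [Finset.mem_filter, Finset.mem_univ, true_and] at hg ⊢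
      exact hZ g hg x
    rw [h1, Finset.card_sdiff_of_subset hsub, Nat.cast_sub (Finset.card_le_card hsub)]
    simp only [Nat.card_eq_fintype_card, Fintype.card_subtype]
  have hdc' : ∑ g ∈ s, ((2 : ℤ) - if g ∈ P then 1 else 0)
      = ∑ x ∈ E, ((Nat.card (stabilizer G x) : ℤ) - Nat.card Z) := by
    rw [← Finset.sum_congr rfl hleft, ← Finset.sum_congr rfl hright]
    exact_mod_cast hdc
  rw [← hdc', Finset.sum_sub_distrib]
  have hs : (s.card : ℤ) = (Nat.card G : ℤ) - Nat.card Z := by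
    have h1 : s = Finset.univ \ (Finset.univ.filter (fun g : G => g ∈ Z)) := by
      ext g; simp [s]
    rw [h1, Finset.card_sdiff_of_subset (Finset.filter_subset _ _),
      Nat.cast_sub (Finset.card_le_card (Finset.filter_subset _ _))]
    simp only [Nat.card_eq_fintype_card, Fintype.card_subtype, Finset.card_univ]
  have hP : ∑ g ∈ s, (if g ∈ P then (1 : ℤ) else 0) = Nat.card P := by
    rw [Finset.sum_boole]
    congr 1
    have : (s.filter (fun g => g ∈ P)) = Finset.univ.filter (fun g => g ∈ P) := by
      ext g
      simp only [s, Finset.mem_filter, Finset.mem_univ, true_and]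
      exact ⟨fun h => h.2, fun h => ⟨hPZ g h, h⟩⟩
    rw [this, Nat.card_eq_fintype_card, Fintype.card_subtype]
  rw [hP, Finset.sum_const, nsmul_eq_mul, hs]
  ring

open Classical in
lemma cardP (Z : Subgroup G) (P : Set G) (x0 : X) (hPZ : ∀ g ∈ P, g ∉ Z)
    (hZ : ∀ g ∈ Z, ∀ x : X, g • x = x) (hP1 : ∀ g ∈ P, ∃ x : X, fixedBy X g = {x})
    (hPc : ∀ g h : G, g ∈ P → h * g * h⁻¹ ∈ P)
    (hR : ∀ x : X, x ∈ orbit G x0 ↔ ∃ g ∈ P, g • x = x) (c : ℕ)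
    (hC : Nat.card {g : G // g • x0 = x0 ∧ (g ∈ P ∨ g ∈ Z)} = c) :
    (Nat.card P : ℤ) = Nat.card (orbit G x0) * ((c : ℤ) - Nat.card Z) := by
  have : Fintype G := Fintype.ofFinite G
  have hc0 : (Nat.card {g : G // g ∈ P ∧ g • x0 = x0} : ℤ) = c - Nat.card Z := by
    rw [← hC]
    have h1 : (Finset.univ.filter (fun g : G => g • x0 = x0 ∧ (g ∈ P ∨ g ∈ Z)))
      = (Finset.univ.filter (fun g : G => g ∈ P ∧ g • x0 = x0)) ∪
        (Finset.univ.filter (fun g : G => g ∈ Z)) := by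
      ext g
      have := hZ g
      simp only [Finset.mem_filter, Finset.mem_univ, true_and, Finset.mem_union]
      constructor
      · tauto
      · rintro (h | h)
        · tauto
        · exact ⟨this h x0, Or.inr h⟩
    have h2 : Disjoint (Finset.univ.filter (fun g : G => g ∈ P ∧ g • x0 = x0))
        (Finset.univ.filter (fun g : G => g ∈ Z)) := by
      rw [Finset.disjoint_filter]
      intro g _ h; exact hPZ g h.1
    have h3 := Finset.card_union_of_disjoint h2
    rw [← h1] at h3
    have e1 := Fintype.card_subtype (fun g : G => g • x0 = x0 ∧ (g ∈ P ∨ g ∈ Z))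
    have e2 := Fintype.card_subtype (fun g : G => g ∈ P ∧ g • x0 = x0)
    have e3 := Fintype.card_subtype (fun g : G => g ∈ Z)
    rw [Nat.card_eq_fintype_card, Nat.card_eq_fintype_card, Nat.card_eq_fintype_card]
    omega
  choose f hf using fun g : P => hP1 g.1 g.2
  have hff : ∀ g : P, g.1 • f g = f g := by
    intro g
    have : f g ∈ fixedBy X g.1 := by rw [hf g]; rfl
    exact this
  let F : P → orbit G x0 := fun g => ⟨f g, (hR _).2 ⟨g.1, g.2, hff g⟩⟩
  have hfin : Finite (orbit G x0) := by
    have : Finite (Set.range fun m : G => m • x0) := Set.finite_range _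
    exact this
  have : Fintype (orbit G x0) := Fintype.ofFinite _
  have hsig : Nat.card P = ∑ y : orbit G x0, Nat.card {g : P // F g = y} := by
    rw [← Nat.card_sigma]
    exact Nat.card_congr (Equiv.sigmaFiberEquiv F).symm
  have hfib : ∀ y : orbit G x0, Nat.card {g : P // F g = y} =
      Nat.card {g : G // g ∈ P ∧ g • x0 = x0} := by
    rintro ⟨y, h, rfl⟩
    symm
    refine Nat.card_congr
      { toFun := fun g => ⟨⟨h * g.1 * h⁻¹, hPc _ _ g.2.1⟩, ?_⟩
        invFun := fun g => ⟨h⁻¹ * g.1.1 * h, ?_, ?_⟩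
        left_inv := ?_
        right_inv := ?_ }
    · apply Subtype.ext
      show f _ = h • x0
      have : h • x0 ∈ fixedBy X (h * g.1 * h⁻¹) := by
        simp [mem_fixedBy, mul_smul, g.2.2]
      have hf' := hf ⟨h * g.1 * h⁻¹, hPc _ _ g.2.1⟩
      simp only at hf'
      rw [hf'] at this
      exact this.symm
    · simpa using hPc _ h⁻¹ g.1.2
    · have h1 : f g.1 = h • x0 := congrArg Subtype.val g.2
      have h2 := hff g.1
      rw [h1] at h2
      rw [mul_smul, mul_smul, h2, inv_smul_smul]
    · intro g; apply Subtype.ext; simp [mul_assoc]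
    · intro g; apply Subtype.ext; apply Subtype.ext; simp [mul_assoc]
  rw [hsig, Finset.sum_congr rfl (fun y _ => hfib y), Finset.sum_const, nsmul_eq_mul]

  push_cast
  rw [hc0, Finset.card_univ, ← Nat.card_eq_fintype_card (α := orbit G x0)]

open Classical in
lemma orbit_sum (Z : Subgroup G) (E : Finset X)
    (hE : ∀ x, x ∈ E → ∀ g : G, g • x ∈ E) (y : X) (hy : y ∈ E) :
    ∑ x ∈ E.filter (fun x => x ∈ orbit G y), ((Nat.card (stabilizer G x) : ℤ) - Nat.card Z)
      = Nat.card G - Nat.card Z * Nat.card (orbit G y) := by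
  have h1 : ((E.filter (fun x => x ∈ orbit G y) : Finset X) : Set X) = orbit G y := by
    ext x
    simp only [Finset.coe_filter, Set.mem_ofPred_eq]
    refine ⟨fun h => h.2, fun h => ⟨?_, h⟩⟩
    obtain ⟨g, rfl⟩ := h
    exact hE y hy g
  have h2 : ((E.filter (fun x => x ∈ orbit G y)).card) = Nat.card (orbit G y) := by
    rw [← Set.ncard_coe_finset, h1]; rfl
  have hpos : 0 < Nat.card (orbit G y) := by
    rw [← h2]
    exact Finset.card_pos.2 ⟨y, by simp [hy]⟩
  have h3 : ∀ x ∈ E.filter (fun x => x ∈ orbit G y),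
      ((Nat.card (stabilizer G x) : ℤ) - Nat.card Z) = Nat.card (stabilizer G y) - Nat.card Z := by
    intro x hx
    have hx' := (Finset.mem_filter.1 hx).2
    have e1 := card_orb_stab (G := G) x
    have e2 := card_orb_stab (G := G) y
    rw [orbit_eq_iff.2 hx', ← e2] at e1
    rw [Nat.eq_of_mul_eq_mul_left hpos e1]
  rw [Finset.sum_congr rfl h3, Finset.sum_const, h2, nsmul_eq_mul, ← card_orb_stab (G := G) y]
  push_cast
  ring

open Classical in
theorem mainCount (p : ℕ) [Fact p.Prime] (Z : Subgroup G) (P : Set G) (x0 : X) (U : Subgroup G)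
    (hPZ : ∀ g ∈ P, g ∉ Z)
    (hZ : ∀ g ∈ Z, ∀ x : X, g • x = x) (hP1 : ∀ g ∈ P, ∃ x : X, fixedBy X g = {x})
    (hP2 : ∀ g, g ∉ P → g ∉ Z → (fixedBy X g).ncard = 2)
    (hPc : ∀ g h : G, g ∈ P → h * g * h⁻¹ ∈ P)
    (hPp : ∀ g ∈ P, ∃ u ∈ P, u ^ p = 1 ∧ ∀ x : X, g • x = x → u • x = x)
    (hU : ∀ u ∈ U, u • x0 = x0) (hU1 : ∀ u ∈ U, u ≠ 1 → u ∈ P)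
    (hq : 3 ≤ Nat.card U)
    (hC : Nat.card {g : G // g • x0 = x0 ∧ (g ∈ P ∨ g ∈ Z)} = Nat.card Z * Nat.card U)
    (k : ℕ) (hS : Nat.card (stabilizer G x0) = Nat.card Z * Nat.card U * k)
    (hk : k ≤ Nat.card U - 1) (hne : ∃ g : G, g • x0 ≠ x0) :
    (∀ y ∈ orbit G x0, y ≠ x0 → ∀ y' ∈ orbit G x0, y' ≠ x0 → ∃ u ∈ U, u • y = y') ∨
    (Nat.card U = 3 ∧ k = 2 ∧ ∀ x, x ∉ orbit G x0 → (∃ g, g ∉ Z ∧ g • x = x) →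
      Nat.card (stabilizer G x) = 5 * Nat.card Z) := by
  have hx0 : ∃ g ∈ P, g • x0 = x0 := by
    have : Nontrivial U := by
      rw [← Finite.one_lt_card_iff_nontrivial]; omega
    obtain ⟨⟨u, hu⟩, hu1⟩ := exists_ne (1 : U)
    exact ⟨u, hU1 u hu (fun h => hu1 (Subtype.ext h)), hU u hu⟩
  have hR : ∀ x : X, x ∈ orbit G x0 ↔ ∃ g ∈ P, g • x = x := by
    intro x
    constructor
    · rintro ⟨h, rfl⟩
      obtain ⟨g, hg, hgx⟩ := hx0
      exact ⟨h * g * h⁻¹, hPc _ _ hg, by simp [mul_smul, hgx]⟩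
    · intro h; exact root_orbit p P hP1 hPp x0 x hx0 h
  obtain ⟨E, hE, hsum⟩ := dcount Z P hPZ hZ hP1 hP2
  rw [cardP Z P x0 hPZ hZ hP1 hPc hR _ hC] at hsum
  obtain ⟨r, hr1, hn, htrans⟩ := free_card x0 P hP1 U hU hU1 hne
  have hZn : ∀ (g h : G), g ∉ Z → (∃ x : X, g • x = x) → h * g * h⁻¹ ∉ Z := by
    rintro g h hg ⟨x, hx⟩ hcon
    have hall : ∀ y : X, g • y = y := by
      intro y
      have := hZ _ hcon (h • y)
      rw [mul_smul, mul_smul, inv_smul_smul] at this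
      exact MulAction.injective h this
    by_cases hgP : g ∈ P
    · exact hPZ _ (hPc g h hgP) hcon
    · have e1 := hP2 g hgP hg
      have hhP : h * g * h⁻¹ ∉ P := fun hh => hPZ _ hh hcon
      have hun : fixedBy X g = Set.univ := by ext y; simp [hall y]
      rw [hun] at e1
      obtain ⟨g', hg', -⟩ := hx0
      obtain ⟨w, hw⟩ := hP1 g' hg'
      have := hne
      have hX : Nat.card X = 2 := by rwa [Set.ncard_univ] at e1
      have hXf : Finite X := Nat.finite_of_card_ne_zero (by omega)
      have h3 : Nat.card (orbit G x0) ≤ Nat.card X := by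
        have := Set.ncard_le_ncard (Set.subset_univ (orbit G x0)) (Set.toFinite _)
        rwa [Set.ncard_univ] at this
      have : 1 * 3 ≤ r * Nat.card U := Nat.mul_le_mul hr1 hq
      omega
  have hEinv : ∀ x, x ∈ E → ∀ g : G, g • x ∈ E := by
    intro x hx g
    obtain ⟨t, ht, htx⟩ := (hE x).1 hx
    exact (hE _).2 ⟨g * t * g⁻¹, hZn t g ht ⟨x, htx⟩, by simp [mul_smul, htx]⟩
  have hx0E : x0 ∈ E := by
    obtain ⟨g, hg, hgx⟩ := hx0
    exact (hE _).2 ⟨g, hPZ g hg, hgx⟩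
  have hzpos : (0 : ℤ) < Nat.card Z := by exact_mod_cast Nat.card_pos
  have hosx := card_orb_stab (G := G) x0
  have hsR := orbit_sum Z E hEinv x0 hx0E
  have hstab : ∀ y ∈ E, ∃ d : ℕ, Nat.card (stabilizer G y) = Nat.card Z * d ∧ 2 ≤ d := by
    intro y hy
    have hle : Z ≤ stabilizer G y := fun g hg => hZ g hg y
    obtain ⟨d, hd⟩ := Subgroup.card_dvd_of_le hle
    refine ⟨d, hd, ?_⟩
    have hd0 : d ≠ 0 := by
      rintro rfl
      have : 0 < Nat.card (stabilizer G y) := Nat.card_pos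
      omega
    have hd1 : d ≠ 1 := by
      rintro rfl
      obtain ⟨t, ht, hty⟩ := (hE y).1 hy
      have := Subgroup.eq_of_le_of_card_ge hle (by omega)
      exact ht (this ▸ hty)
    omega
  have hcontr : ∀ y ∈ E, (2 * (Nat.card Z * Nat.card (orbit G y)) : ℤ) ≤ Nat.card G := by
    intro y hy
    obtain ⟨d, hd, hd2⟩ := hstab y hy
    have h1 := card_orb_stab (G := G) y
    rw [hd] at h1
    have : 2 * (Nat.card Z * Nat.card (orbit G y)) ≤ Nat.card G := by
      rw [← h1]
      nlinarith [Nat.zero_le (Nat.card Z * Nat.card (orbit G y))]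
    exact_mod_cast this
  have hsplit := Finset.sum_filter_add_sum_filter_not E (fun x => x ∈ orbit G x0)
    (fun x => ((Nat.card (stabilizer G x) : ℤ) - Nat.card Z))
  set n := Nat.card (orbit G x0) with hndef
  set z := Nat.card Z with hzdef
  set q := Nat.card U with hqdef
  set N := Nat.card G with hNdef
  set E' := E.filter (fun x => ¬ x ∈ orbit G x0) with hE'def
  have hE'sum : ∑ x ∈ E', ((Nat.card (stabilizer G x) : ℤ) - z) = N - 2 * z - z * n * ((q : ℤ) - 2) := by
    rw [hsR] at hsplit
    rw [← hsplit] at hsum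
    push_cast at hsum
    linarith
  have hq' : (3 : ℤ) ≤ q := by exact_mod_cast hq
  have hn4 : 4 ≤ n := by
    have : 1 * 3 ≤ r * q := Nat.mul_le_mul hr1 hq
    omega
  have hlt : ∑ x ∈ E', ((Nat.card (stabilizer G x) : ℤ) - z) < N := by
    rw [hE'sum]
    have : (0 : ℤ) ≤ z * n * ((q : ℤ) - 2) := by
      apply mul_nonneg
      · positivity
      · linarith
    linarith
  have hE'inv : ∀ x, x ∈ E' → ∀ g : G, g • x ∈ E' := by
    intro x hx g
    rw [hE'def, Finset.mem_filter] at hx ⊢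
    refine ⟨hEinv x hx.1 g, fun h => hx.2 ?_⟩
    have h1 : orbit G (g • x) = orbit G x := orbit_eq_iff.2 ⟨g, rfl⟩
    rw [← orbit_eq_iff, h1] at h
    exact orbit_eq_iff.1 h
  have hE'E : ∀ x ∈ E', x ∈ E := fun x hx => (Finset.mem_filter.1 hx).1
  have hone : ∀ y ∈ E', ∀ y' ∈ E', y' ∈ orbit G y := by
    intro y hy y' hy'
    by_contra hcon
    have h1 := orbit_sum Z E' hE'inv y hy
    have h2 := orbit_sum Z (E'.filter (fun x => ¬ x ∈ orbit G y)) (by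
      intro x hx g
      rw [Finset.mem_filter] at hx ⊢
      refine ⟨hE'inv x hx.1 g, fun h => hx.2 ?_⟩
      have h1 : orbit G (g • x) = orbit G x := orbit_eq_iff.2 ⟨g, rfl⟩
      rw [← orbit_eq_iff, h1] at h
      exact orbit_eq_iff.1 h) y' (by simp [hy', hcon])
    have h3 := Finset.sum_filter_add_sum_filter_not E' (fun x => x ∈ orbit G y)
      (fun x => ((Nat.card (stabilizer G x) : ℤ) - z))
    have h4 := Finset.sum_filter_add_sum_filter_not (E'.filter (fun x => ¬ x ∈ orbit G y))
      (fun x => x ∈ orbit G y')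
      (fun x => ((Nat.card (stabilizer G x) : ℤ) - z))
    have h5 : 0 ≤ ∑ x ∈ (E'.filter (fun x => ¬ x ∈ orbit G y)).filter (fun x => ¬ x ∈ orbit G y'),
        ((Nat.card (stabilizer G x) : ℤ) - z) := by
      apply Finset.sum_nonneg
      intro x hx
      have hxE := hE'E x (Finset.mem_filter.1 (Finset.mem_filter.1 hx).1).1
      obtain ⟨d, hd, hd2⟩ := hstab x hxE
      rw [hd]
      push_cast
      nlinarith
    have c1 := hcontr y (hE'E y hy)
    have c2 := hcontr y' (hE'E y' hy')
    linarith
  have hNn : (N : ℤ) = n * (z * q * k) := by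
    rw [← hosx, hS]; push_cast; ring
  have hk1 : 1 ≤ k := by
    rcases Nat.eq_zero_or_pos k with h | h
    · rw [h, mul_zero] at hS
      have : 0 < Nat.card (stabilizer G x0) := Nat.card_pos
      omega
    · exact h
  have hk' : (k : ℤ) ≤ q - 1 := by omega
  rcases E'.eq_empty_or_nonempty with hemp | ⟨y, hy⟩
  · exfalso
    rw [hemp, Finset.sum_empty, hNn] at hE'sum
    have h1 : (n : ℤ) * (q * k - q + 2) = 2 := by
      apply mul_left_cancel₀ hzpos.ne'
      linarith
    have h2 : (4 : ℤ) ≤ n := by exact_mod_cast hn4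
    have h3 : (1 : ℤ) ≤ k := by exact_mod_cast hk1
    have h4 : (q : ℤ) * 1 ≤ q * k := by
      apply mul_le_mul_of_nonneg_left h3; positivity
    nlinarith
  · obtain ⟨d, hd, hd2⟩ := hstab y (hE'E y hy)
    have h1 := orbit_sum Z E' hE'inv y hy
    have h2 : E'.filter (fun x => x ∈ orbit G y) = E' :=
      Finset.filter_true_of_mem (fun x hx => hone y hy x hx)
    rw [h2, hE'sum] at h1
    have h3 := card_orb_stab (G := G) y
    have := numLemma n q k z N (Nat.card (orbit G y)) r (Nat.card (stabilizer G y)) d hzpos hq'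
      (by exact_mod_cast hr1) (by exact_mod_cast hn) hNn (by exact_mod_cast hk1) hk'
      (by exact_mod_cast hd) (by exact_mod_cast h3) (by linarith)
    rcases this with h | ⟨h5, h6, h7⟩
    · left; exact htrans (by exact_mod_cast h)
    · right
      refine ⟨by exact_mod_cast h5, by exact_mod_cast h6, ?_⟩
      intro x hx hxg
      have hxE' : x ∈ E' := Finset.mem_filter.2 ⟨(hE x).2 hxg, hx⟩
      have h8 := hone y hy x hxE'
      have e1 := card_orb_stab (G := G) x
      rw [orbit_eq_iff.2 h8, ← h3] at e1
      have hpos : 0 < Nat.card (orbit G y) := by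
        rcases Nat.eq_zero_or_pos (Nat.card (orbit G y)) with h0 | h0
        · rw [h0, zero_mul] at h3
          have : 0 < Nat.card G := Nat.card_pos
          omega
        · exact h0
      rw [Nat.eq_of_mul_eq_mul_left hpos e1]
      exact_mod_cast h7
end

section
open Matrix.GeneralLinearGroup OnePoint

variable {K : Type*} [Field K]

lemma pow_one_add (m : Matrix (Fin 2) (Fin 2) K) (hm : m * m = 0) (k : ℕ) :
    (1 + m) ^ k = 1 + (k : K) • m := by
  induction k with
  | zero => simp
  | succ k ih =>
    rw [pow_succ, ih, mul_add, mul_one, add_mul, one_mul, smul_mul_assoc, hm, smul_zero, add_zero]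
    push_cast
    rw [add_smul, one_smul]
    abel

lemma exists_pow_unip (p : ℕ) [Fact p.Prime] [CharP K p] (g : GL (Fin 2) K) (hg : IsOfFinOrder g)
    (a : K) (m : Matrix (Fin 2) (Fin 2) K) (h : g.val = a • (1 + m)) (hm : m * m = 0) :
    ∃ k : ℕ, (g ^ k).val = 1 + m := by
  have hp : p.Prime := Fact.out
  have hpow : ∀ k : ℕ, (g ^ k).val = a ^ k • (1 + (k : K) • m) := by
    intro k
    rw [Units.val_pow_eq_pow_val, h, smul_pow, pow_one_add m hm]
  obtain ⟨N, hN, hgN⟩ := isOfFinOrder_iff_pow_eq_one.1 hg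
  have haN : a ^ (N * p) = 1 := by
    have h1 := hpow (N * p)
    rw [pow_mul g, hgN, one_pow] at h1
    have h2 := congrFun (congrFun h1 0) 0
    simp at h2
    exact h2.symm
  have hfa : IsOfFinOrder a := isOfFinOrder_iff_pow_eq_one.2 ⟨N * p, Nat.mul_pos hN hp.pos, haN⟩
  have hM : 0 < orderOf a := hfa.orderOf_pos
  have hcop : Nat.Coprime (orderOf a) p := by
    rw [Nat.coprime_comm, hp.coprime_iff_not_dvd]
    rintro ⟨d, hd⟩
    have h1 : (a ^ d) ^ p = 1 := by rw [← pow_mul, mul_comm, ← hd, pow_orderOf_eq_one]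
    have h2 : (a ^ d - 1) ^ p = 0 := by rw [sub_pow_char, h1, one_pow, sub_self]
    have h3 : a ^ d = 1 := sub_eq_zero.1 (pow_eq_zero_iff hp.ne_zero |>.1 h2)
    have h4 := orderOf_dvd_of_pow_eq_one h3
    have hd0 : 0 < d := by
      rcases Nat.eq_zero_or_pos d with h | h
      · rw [h] at hd; omega
      · exact h
    have h5 := Nat.le_of_dvd hd0 h4
    have := hp.two_le
    nlinarith
  obtain ⟨k, hk1, hk2⟩ := Nat.chineseRemainder hcop 0 1
  refine ⟨k, ?_⟩
  have h1 : a ^ k = 1 := orderOf_dvd_iff_pow_eq_one.1 ((Nat.modEq_zero_iff_dvd).1 hk1)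
  have h2 : (k : K) = 1 := by
    have := (CharP.natCast_eq_natCast K p).2 hk2
    simpa using this
  rw [hpow, h1, h2, one_smul, one_smul]

/-- scalar matrices -/
def IsSc (g : GL (Fin 2) K) : Prop := g 1 0 = 0 ∧ g 0 1 = 0 ∧ g 0 0 = g 1 1

lemma isSc_iff (g : GL (Fin 2) K) : IsSc g ↔ g.val ∈ Set.range (Matrix.scalar (Fin 2)) := by
  constructor
  · rintro ⟨h1, h2, h3⟩
    refine ⟨g 0 0, ?_⟩
    ext i j
    fin_cases i <;> fin_cases j <;> simp [h1, h2, h3]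
  · rintro ⟨a, ha⟩
    simp [IsSc, ← ha]

variable [DecidableEq K]

lemma IsSc.smul {g : GL (Fin 2) K} (h : IsSc g) (x : OnePoint K) : g • x = x := by
  obtain ⟨h1, h2, h3⟩ := h
  have hd : g 1 1 ≠ 0 := by
    intro h4
    apply g.det_ne_zero
    rw [det_fin_two, h1, h4]; ring
  cases x with
  | infty => rw [smul_infty_eq_ite, if_pos h1]
  | coe x =>
    rw [smul_some_eq_ite, h1, h2, h3]
    simp [hd]

lemma fixed_iff (g : GL (Fin 2) K) (x : K) :
    g • (x : OnePoint K) = x ↔ g 1 0 * x ^ 2 + (g 1 1 - g 0 0) * x - g 0 1 = 0 := by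
  rw [← fixpointPolynomial_aeval_eq_zero_iff]
  simp [fixpointPolynomial]

lemma fixed_two [IsAlgClosed K] [NeZero (2 : K)] (g : GL (Fin 2) K) (hP : ¬ g.IsParabolic)
    (hS : ¬ IsSc g) : (fixedBy (OnePoint K) g).ncard = 2 := by
  have hdisc : (g 0 0 - g 1 1) ^ 2 + 4 * g 0 1 * g 1 0 ≠ 0 := by
    intro h
    apply hP
    refine ⟨fun h => hS ((isSc_iff g).2 h), ?_⟩
    rw [discr_fin_two, trace_fin_two, det_fin_two, ← h]; ring
  by_cases hc : g 1 0 = 0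
  · have had : g 1 1 - g 0 0 ≠ 0 := by
      intro h
      apply hdisc
      rw [hc, ← neg_sub, h]; ring
    have : fixedBy (OnePoint K) g = {∞, ((g 0 1 / (g 1 1 - g 0 0) : K) : OnePoint K)} := by
      ext x
      rw [mem_fixedBy]
      cases x with
      | infty => simp [smul_infty_eq_ite, hc]
      | coe x =>
        rw [fixed_iff, hc]
        simp only [Set.mem_insert_iff, coe_ne_infty, Set.mem_singleton_iff, coe_eq_coe, false_or]
        rw [eq_div_iff had]
        constructor <;> intro h <;> linear_combination h
    rw [this, Set.ncard_pair (infty_ne_coe _)]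
  · obtain ⟨s, hs⟩ := IsAlgClosed.exists_pow_nat_eq ((g 0 0 - g 1 1) ^ 2 + 4 * g 0 1 * g 1 0)
      (n := 2) (by norm_num)
    have h2 : (2 : K) ≠ 0 := NeZero.ne _
    have hs0 : s ≠ 0 := by
      rintro rfl; apply hdisc; rw [← hs]; ring
    have : fixedBy (OnePoint K) g = {(((g 0 0 - g 1 1 + s) / (2 * g 1 0) : K) : OnePoint K),
        (((g 0 0 - g 1 1 - s) / (2 * g 1 0) : K) : OnePoint K)} := by
      ext x
      rw [mem_fixedBy]
      cases x with
      | infty => simp [smul_infty_eq_ite, hc]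
      | coe x =>
        rw [fixed_iff]
        simp only [Set.mem_insert_iff, Set.mem_singleton_iff, coe_eq_coe]
        have h2c : 2 * g 1 0 ≠ 0 := mul_ne_zero h2 hc
        rw [eq_div_iff h2c, eq_div_iff h2c]
        have key : (x * (2 * g 1 0) - (g 0 0 - g 1 1 + s)) * (x * (2 * g 1 0) - (g 0 0 - g 1 1 - s))
            = 4 * g 1 0 * (g 1 0 * x ^ 2 + (g 1 1 - g 0 0) * x - g 0 1) := by
          linear_combination -hs
        constructor
        · intro h
          rw [h, mul_zero, mul_eq_zero, sub_eq_zero, sub_eq_zero] at key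
          exact key
        · intro h
          have h0 : 4 * g 1 0 * (g 1 0 * x ^ 2 + (g 1 1 - g 0 0) * x - g 0 1) = 0 := by
            rw [← key]
            rcases h with h | h <;> rw [h] <;> ring
          have h4 : (4 : K) * g 1 0 ≠ 0 := by
            rw [show (4 : K) = 2 * 2 by norm_num]
            exact mul_ne_zero (mul_ne_zero h2 h2) hc
          exact (mul_eq_zero.1 h0).resolve_left h4
    rw [this, Set.ncard_pair]
    rw [Ne, coe_eq_coe, div_left_inj' (mul_ne_zero h2 hc)]
    intro h
    apply mul_ne_zero h2 hs0
    linear_combination h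

lemma fixed_one [NeZero (2 : K)] (g : GL (Fin 2) K) (hP : g.IsParabolic) :
    ∃ x, fixedBy (OnePoint K) g = {x} := by
  refine ⟨parabolicFixedPoint g, ?_⟩
  ext x
  rw [mem_fixedBy, hP.smul_eq_self_iff]; rfl

/-- a parabolic element has a unipotent power -/
lemma parab_pow (p : ℕ) [Fact p.Prime] [CharP K p] [NeZero (2 : K)] (g : GL (Fin 2) K)
    (hg : IsOfFinOrder g) (hP : g.IsParabolic) :
    ∃ k : ℕ, (g ^ k).IsParabolic ∧ (g ^ k) ^ p = 1 := by
  obtain ⟨a, m, h1, hm0, hm⟩ := isParabolic_iff_exists.1 hP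
  rw [sq] at hm
  have ha : a ≠ 0 := by
    rintro rfl
    rw [map_zero, zero_add] at h1
    apply (g * g).det_ne_zero
    rw [Units.val_mul, h1, hm]; simp
  have hm' : (a⁻¹ • m) * (a⁻¹ • m) = 0 := by
    rw [smul_mul_smul_comm, hm, smul_zero]
  obtain ⟨k, hk⟩ := exists_pow_unip p g hg a (a⁻¹ • m) (by
    rw [h1, smul_add, smul_smul, mul_inv_cancel₀ ha, one_smul]
    congr 1
    ext i j; fin_cases i <;> fin_cases j <;> simp) hm'
  refine ⟨k, isParabolic_iff_exists.2 ⟨1, a⁻¹ • m, by rw [hk, map_one], ?_, by rw [sq, hm']⟩, ?_⟩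
  · exact smul_ne_zero (inv_ne_zero ha) hm0
  · apply Units.ext
    rw [Units.val_pow_eq_pow_val, hk, pow_one_add _ hm']
    simp
end

section
open Matrix.GeneralLinearGroup OnePoint

variable {K : Type*} [Field K] [DecidableEq K]

/-- the subgroup of scalar matrices in `H` -/
def scSub (H : Subgroup (GL (Fin 2) K)) : Subgroup H where
  carrier := {g | IsSc (g : GL (Fin 2) K)}
  one_mem' := by simp [IsSc]
  mul_mem' := by
    rintro a b ha hb
    rw [Set.mem_ofPred_eq, isSc_iff] at *
    obtain ⟨x, hx⟩ := ha
    obtain ⟨y, hy⟩ := hb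
    exact ⟨x * y, by simp [map_mul, hx, hy]⟩
  inv_mem' := by
    rintro a ha
    have h1 := ha.1
    have h2 := ha.2.1
    have h3 := ha.2.2
    rw [Set.mem_ofPred_eq]
    simp [IsSc, Matrix.inv_def, Matrix.adjugate_fin_two, h1, h2, h3]

/-- upper unipotent subgroup of `H` -/
def uSub (H : Subgroup (GL (Fin 2) K)) : Subgroup H :=
  ((upperRightHom (R := K)).toMonoidHom.range).comap H.subtype

lemma mem_uSub (H : Subgroup (GL (Fin 2) K)) (g : H) :
    g ∈ uSub H ↔ ∃ t : K, upperRightHom t = (g : GL (Fin 2) K) := by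
  constructor
  · rintro ⟨t, ht⟩; exact ⟨t.toAdd, ht⟩
  · rintro ⟨t, ht⟩; exact ⟨Multiplicative.ofAdd t, ht⟩

lemma u_parab (t : K) (ht : t ≠ 0) : (upperRightHom t).IsParabolic := by
  rw [Matrix.GeneralLinearGroup.isParabolic_iff_of_upperTriangular (by simp)]
  simp [ht]

lemma cardC (p : ℕ) [Fact p.Prime] [CharP K p] (H : Subgroup (GL (Fin 2) K)) [Finite H] :
    Nat.card {g : H // g • (∞ : OnePoint K) = ∞ ∧
      (g ∈ {g : H | (g : GL (Fin 2) K).IsParabolic} ∨ g ∈ scSub H)} =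
      Nat.card (scSub H) * Nat.card (uSub H) := by
  rw [← Nat.card_prod]
  symm
  have hmem : ∀ s ∈ scSub H, ∀ u ∈ uSub H, (s * u) • (∞ : OnePoint K) = ∞ ∧
      ((s * u) ∈ {g : H | (g : GL (Fin 2) K).IsParabolic} ∨ (s * u) ∈ scSub H) := by
    rintro s hs u hu
    have hs' := hs
    obtain ⟨t, ht⟩ := (mem_uSub H u).1 hu
    obtain ⟨h1, h2, h3⟩ := hs
    have e10 : ((s * u : H) : GL (Fin 2) K) 1 0 = 0 := by
      simp [← ht, Matrix.mul_apply, h1]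
    refine ⟨smul_infty_eq_self_iff.2 e10, ?_⟩
    by_cases ht0 : t = 0
    · right
      have : u = 1 := by
        apply Subtype.ext
        rw [← ht, ht0]; exact AddChar.map_zero_eq_one _
      rw [this, mul_one]; exact hs'
    · left
      show IsParabolic ((s * u : H) : GL (Fin 2) K)
      rw [Matrix.GeneralLinearGroup.isParabolic_iff_of_upperTriangular e10]
      have hd : (s : GL (Fin 2) K) 1 1 ≠ 0 := by
        intro h4
        apply (s : GL (Fin 2) K).det_ne_zero
        rw [det_fin_two, h1, h4]; ring
      simp [← ht, Matrix.mul_apply, h1, h2, h3, hd, ht0]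
  refine Nat.card_congr (Equiv.ofBijective
    (fun su : scSub H × uSub H => ⟨su.1.1 * su.2.1, hmem _ su.1.2 _ su.2.2⟩) ⟨?_, ?_⟩)
  · rintro ⟨⟨s, hs⟩, ⟨u, hu⟩⟩ ⟨⟨s', hs'⟩, ⟨u', hu'⟩⟩ h
    have h0 : s * u = s' * u' := congrArg Subtype.val h
    have h1 : s'⁻¹ * s = u' * u⁻¹ := by
      rw [inv_mul_eq_iff_eq_mul, ← mul_assoc, ← h0]; simp
    have h2 : s'⁻¹ * s ∈ scSub H := mul_mem (inv_mem hs') hs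
    have h3 : u' * u⁻¹ ∈ uSub H := mul_mem hu' (inv_mem hu)
    obtain ⟨t, ht⟩ := (mem_uSub H _).1 h3
    rw [h1] at h2
    have h4 : IsSc ((u' * u⁻¹ : H) : GL (Fin 2) K) := h2
    rw [← ht] at h4
    have h5 : t = 0 := by simpa using h4.2.1
    have h6 : u' * u⁻¹ = 1 := by
      apply Subtype.ext
      rw [← ht, h5]; exact AddChar.map_zero_eq_one _
    have h7 : s'⁻¹ * s = 1 := by rw [h1, h6]
    have h8 : s = s' := (inv_mul_eq_one.1 h7).symm
    have h9 : u = u' := (mul_inv_eq_one.1 h6).symm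
    subst h8; subst h9; rfl
  · rintro ⟨g, hg, hg'⟩
    have h10 : (g : GL (Fin 2) K) 1 0 = 0 := smul_infty_eq_self_iff.1 hg
    have h00 : (g : GL (Fin 2) K) 0 0 = (g : GL (Fin 2) K) 1 1 := by
      rcases hg' with h | h
      · exact ((Matrix.GeneralLinearGroup.isParabolic_iff_of_upperTriangular h10).1 h).1
      · exact h.2.2
    have hd : (g : GL (Fin 2) K) 1 1 ≠ 0 := by
      intro h4
      apply (g : GL (Fin 2) K).det_ne_zero
      rw [det_fin_two, h10, h4]; ring
    set a := (g : GL (Fin 2) K) 1 1 with ha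
    set b := (g : GL (Fin 2) K) 0 1 with hb
    have hfo : IsOfFinOrder (g : GL (Fin 2) K) :=
      MonoidHom.isOfFinOrder H.subtype (isOfFinOrder_of_finite g)
    obtain ⟨k, hk⟩ := exists_pow_unip p (g : GL (Fin 2) K) hfo a !![0, b / a; 0, 0] (by
      ext i j
      fin_cases i <;> fin_cases j <;> simp [h00, h10, ← ha, ← hb]
      field_simp) (by ext i j; fin_cases i <;> fin_cases j <;> simp)
    have hu : g ^ k ∈ uSub H := by
      rw [mem_uSub]
      refine ⟨b / a, ?_⟩
      apply Units.ext
      rw [Subgroup.coe_pow, hk]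
      ext i j
      fin_cases i <;> fin_cases j <;> simp
    obtain ⟨t, ht⟩ := (mem_uSub H _).1 hu
    have ht' : t = b / a := by
      have := congrArg (fun x : GL (Fin 2) K => x 0 1) ht
      simp only [Subgroup.coe_pow] at this
      rw [hk] at this
      simpa using this
    have hs : g * (g ^ k)⁻¹ ∈ scSub H := by
      show IsSc ((g * (g ^ k)⁻¹ : H) : GL (Fin 2) K)
      have : ((g * (g ^ k)⁻¹ : H) : GL (Fin 2) K) = (g : GL (Fin 2) K) * upperRightHom (-t) := by
        rw [Subgroup.coe_mul, Subgroup.coe_inv, ← ht, AddChar.map_neg_eq_inv]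
      rw [this]
      refine ⟨?_, ?_, ?_⟩
      · simp [Matrix.mul_apply, h10]
      · simp [Matrix.mul_apply, ht', h00, ← ha, ← hb]
        field_simp
        ring
      · simp [Matrix.mul_apply, h10, h00, ← ha]
    refine ⟨(⟨_, hs⟩, ⟨_, hu⟩), ?_⟩
    apply Subtype.ext
    simp

/-- ratio of the eigenvalues on the stabiliser of infinity -/
noncomputable def chi (H : Subgroup (GL (Fin 2) K)) : stabilizer H (∞ : OnePoint K) →* Kˣ :=
  MonoidHom.toHomUnits
    { toFun := fun g => (g.1 : GL (Fin 2) K) 0 0 / (g.1 : GL (Fin 2) K) 1 1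
      map_one' := by simp
      map_mul' := by
        rintro ⟨g, hg⟩ ⟨h, hh⟩
        have h1 : (g : GL (Fin 2) K) 1 0 = 0 := smul_infty_eq_self_iff.1 hg
        have h2 : (h : GL (Fin 2) K) 1 0 = 0 := smul_infty_eq_self_iff.1 hh
        simp [Matrix.mul_apply, h1, h2, mul_div_mul_comm] }

lemma chi_apply (H : Subgroup (GL (Fin 2) K)) (g : stabilizer H (∞ : OnePoint K)) :
    (chi H g : K) = (g.1 : GL (Fin 2) K) 0 0 / (g.1 : GL (Fin 2) K) 1 1 := rfl

lemma cardStab (p : ℕ) [Fact p.Prime] [CharP K p] (H : Subgroup (GL (Fin 2) K)) [Finite H] :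
    Nat.card (stabilizer H (∞ : OnePoint K)) =
      Nat.card (scSub H) * Nat.card (uSub H) * Nat.card (chi H).range := by
  rw [← cardC p H, ← Subgroup.card_mul_index (chi H).ker, Subgroup.index_ker]
  congr 1
  refine Nat.card_congr
    { toFun := fun g => ⟨g.1.1, g.1.2, ?_⟩
      invFun := fun g => ⟨⟨g.1, g.2.1⟩, ?_⟩
      left_inv := fun g => rfl
      right_inv := fun g => rfl }
  · have h10 : (g.1.1 : GL (Fin 2) K) 1 0 = 0 := smul_infty_eq_self_iff.1 g.1.2
    have hk : chi H g.1 = 1 := g.2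
    have hk' := congrArg Units.val hk
    rw [chi_apply, Units.val_one] at hk'
    have h00 := eq_of_div_eq_one hk'
    by_cases h01 : (g.1.1 : GL (Fin 2) K) 0 1 = 0
    · right; exact ⟨h10, h01, h00⟩
    · left; exact (Matrix.GeneralLinearGroup.isParabolic_iff_of_upperTriangular h10).2 ⟨h00, h01⟩
  · obtain ⟨g, hg, hg'⟩ := g
    have h10 : (g : GL (Fin 2) K) 1 0 = 0 := smul_infty_eq_self_iff.1 hg
    have h00 : (g : GL (Fin 2) K) 0 0 = (g : GL (Fin 2) K) 1 1 := by
      rcases hg' with h | h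
      · exact ((Matrix.GeneralLinearGroup.isParabolic_iff_of_upperTriangular h10).1 h).1
      · exact h.2.2
    have hd : (g : GL (Fin 2) K) 1 1 ≠ 0 := by
      intro h4
      apply (g : GL (Fin 2) K).det_ne_zero
      rw [det_fin_two, h10, h4]; ring
    rw [MonoidHom.mem_ker]
    apply Units.ext
    rw [chi_apply, Units.val_one]
    show (g : GL (Fin 2) K) 0 0 / (g : GL (Fin 2) K) 1 1 = 1
    rw [h00, div_self hd]

lemma conj_u (g : GL (Fin 2) K) (h10 : g 1 0 = 0) (t : K) :
    g * upperRightHom t * g⁻¹ = upperRightHom (g 0 0 / g 1 1 * t) := by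
  have hd : g 1 1 ≠ 0 := by
    intro h4
    apply g.det_ne_zero
    rw [det_fin_two, h10, h4]; ring
  rw [mul_inv_eq_iff_eq_mul]
  apply Units.ext
  ext i j
  fin_cases i <;> fin_cases j <;> simp [Matrix.mul_apply, h10]
  field_simp
  ring

lemma cardRange (H : Subgroup (GL (Fin 2) K)) [Finite H] (h1 : upperRightHom (1 : K) ∈ H) :
    Nat.card (chi H).range ≤ Nat.card (uSub H) - 1 := by
  have hmem : ∀ t ∈ (chi H).range, upperRightHom (t : K) ∈ H := by
    rintro t ⟨g, rfl⟩
    rw [chi_apply, ← mul_one (_ / _), ← conj_u _ (smul_infty_eq_self_iff.1 g.2)]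
    exact H.mul_mem (H.mul_mem g.1.2 h1) (H.inv_mem g.1.2)
  let f : (chi H).range → {u : uSub H // u ≠ 1} := fun t =>
    ⟨⟨⟨upperRightHom (t.1 : K), hmem _ t.2⟩, (mem_uSub H _).2 ⟨_, rfl⟩⟩, by
      intro h
      have h2 : upperRightHom ((t : Kˣ) : K) = 1 := congrArg (fun x : uSub H => (x.1 : GL (Fin 2) K)) h
      have h3 := congrArg (fun x : GL (Fin 2) K => x 0 1) h2
      simp at h3⟩
  have hf : Function.Injective f := by
    rintro ⟨t, ht⟩ ⟨t', ht'⟩ h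
    have h2 : upperRightHom (t : K) = upperRightHom (t' : K) :=
      congrArg (fun x : {u : uSub H // u ≠ 1} => (x.1.1 : GL (Fin 2) K)) h
    have h3 := injective_upperRightHom h2
    apply Subtype.ext
    exact Units.ext h3
  have e1 := Nat.card_le_card_of_injective f hf
  have e2 : Nat.card {u : uSub H // u ≠ 1} < Nat.card (uSub H) :=
    Finite.card_subtype_lt (x := 1) (by simp)
  omega
end

section
open Matrix.GeneralLinearGroup OnePoint

variable {K : Type*} [Field K] [DecidableEq K]

lemma conj_entries (g : GL (Fin 2) K) (t : K) :
    (g * upperRightHom t * g⁻¹) 1 0 = - (g 1 0) ^ 2 * t / g.val.det ∧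
    (g * upperRightHom t * g⁻¹) 0 0 = 1 - g 0 0 * g 1 0 * t / g.val.det ∧
    (g * upperRightHom t * g⁻¹) 1 1 = 1 + g 0 0 * g 1 0 * t / g.val.det ∧
    (g * upperRightHom t * g⁻¹) 0 1 = (g 0 0) ^ 2 * t / g.val.det := by
  have hd := g.det_ne_zero
  refine ⟨?_, ?_, ?_, ?_⟩ <;>
  · simp only [coe_mul, coe_inv, Matrix.inv_def, Ring.inverse_eq_inv', Matrix.adjugate_fin_two,
      Matrix.mul_apply, Fin.sum_univ_two, upperRightHom_apply, Matrix.smul_apply,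
      smul_eq_mul, Matrix.of_apply, Matrix.cons_val_zero, Matrix.cons_val_one]
    simp
    field_simp
    try rw [det_fin_two]
    try ring

lemma trans_case (H : Subgroup (GL (Fin 2) K))
    (h1 : upperRightHom (1 : K) ∈ H) (g : H) (hg : (g : GL (Fin 2) K) 1 0 ≠ 0)
    (htr : ∀ y ∈ orbit H (∞ : OnePoint K), y ≠ ∞ → ∀ y' ∈ orbit H (∞ : OnePoint K), y' ≠ ∞ →
      ∃ u ∈ uSub H, u • y = y') :
    ∃ g : GL (Fin 2) K, ∃ t, g * upperRightHom t * g⁻¹ ∈ H ∧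
      (g * upperRightHom t * g⁻¹) 1 0 = 1 := by
  let u1 : H := ⟨_, h1⟩
  have e1 : g • (∞ : OnePoint K) =
      (((g : GL (Fin 2) K) 0 0 / (g : GL (Fin 2) K) 1 0 : K) : OnePoint K) := by
    show (g : GL (Fin 2) K) • (∞ : OnePoint K) = _
    rw [smul_infty_eq_ite, if_neg hg]
  have e2 : ∀ x : K, u1 • (x : OnePoint K) = ((x + 1 : K) : OnePoint K) := by
    intro x
    show (upperRightHom (1 : K)) • (x : OnePoint K) = _
    rw [smul_some_eq_ite]
    simp
  obtain ⟨u, hu, hu'⟩ := htr (g⁻¹ • ∞) ⟨g⁻¹, rfl⟩ (by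
      intro h
      rw [inv_smul_eq_iff, e1] at h
      exact infty_ne_coe _ h) ((g⁻¹ * u1 * g) • ∞) ⟨_, rfl⟩ (by
      intro h
      rw [mul_smul, mul_smul, inv_smul_eq_iff, e1, e2, coe_eq_coe] at h
      simp at h)
  obtain ⟨t, ht⟩ := (mem_uSub H u).1 hu
  have e3 : (g * u * g⁻¹) • (∞ : OnePoint K) =
      (((g : GL (Fin 2) K) 0 0 / (g : GL (Fin 2) K) 1 0 + 1 : K) : OnePoint K) := by
    rw [mul_smul, mul_smul, hu', mul_smul, mul_smul, smul_inv_smul, e1, e2]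
  have e4 : ((g : GL (Fin 2) K) * upperRightHom t * (g : GL (Fin 2) K)⁻¹) • (∞ : OnePoint K) =
      (((g : GL (Fin 2) K) 0 0 / (g : GL (Fin 2) K) 1 0 + 1 : K) : OnePoint K) := by
    rw [ht]; exact e3
  refine ⟨g, t, ?_, ?_⟩
  · rw [ht]; exact (g * u * g⁻¹).2
  obtain ⟨c1, c2, -, -⟩ := conj_entries (g : GL (Fin 2) K) t
  rw [smul_infty_eq_ite] at e4
  split_ifs at e4 with hc
  · exact absurd e4 (infty_ne_coe _)
  rw [coe_eq_coe, div_eq_iff hc] at e4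
  have hd := (g : GL (Fin 2) K).det_ne_zero
  have c3 : ((g : GL (Fin 2) K) * upperRightHom t * (g : GL (Fin 2) K)⁻¹) 0 0 =
      1 + (g : GL (Fin 2) K) 0 0 / (g : GL (Fin 2) K) 1 0 *
      ((g : GL (Fin 2) K) * upperRightHom t * (g : GL (Fin 2) K)⁻¹) 1 0 := by
    rw [c1, c2]; field_simp; ring
  linear_combination c3 - e4

/-- squaring trick -/
lemma sq_step (H : Subgroup (GL (Fin 2) K)) (h1 : upperRightHom (1 : K) ∈ H)
    (g : GL (Fin 2) K) (hg : g ∈ H) (hd : g.val.det = 1) :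
    ∃ g' ∈ H, g'.val.det = 1 ∧ (g' 1 0) = - (g 1 0) ^ 2 ∧
      ∃ h : GL (Fin 2) K, g' = h * upperRightHom 1 * h⁻¹ := by
  refine ⟨g * upperRightHom 1 * g⁻¹, H.mul_mem (H.mul_mem hg h1) (H.inv_mem hg), ?_, ?_,
    g, rfl⟩
  · simp [hd]
  · rw [(conj_entries g 1).1, hd]; simp

lemma pow5 (w : Matrix (Fin 2) (Fin 2) K) :
    (w ^ 5) 1 0 = w 1 0 * ((w 0 0 + w 1 1) ^ 4 - 3 * (w 0 0 + w 1 1) ^ 2 *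
      (w 0 0 * w 1 1 - w 0 1 * w 1 0) + (w 0 0 * w 1 1 - w 0 1 * w 1 0) ^ 2) := by
  simp only [pow_succ, pow_zero, one_mul, Matrix.mul_apply, Fin.sum_univ_two]
  ring

lemma exc_case (H : Subgroup (GL (Fin 2) K)) [IsAlgClosed K] [NeZero (2 : K)] [Finite H]
    (h3 : (3 : K) = 0)
    (h1 : upperRightHom (1 : K) ∈ H) (g : H) (hg : (g : GL (Fin 2) K) 1 0 ≠ 0)
    (hk : Nat.card (chi H).range = 2)
    (hst : ∀ x, x ∉ orbit H (∞ : OnePoint K) → (∃ g, g ∉ scSub H ∧ g • x = x) →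
      Nat.card (stabilizer H x) = 5 * Nat.card (scSub H)) :
    ∃ g : GL (Fin 2) K, ∃ t, g * upperRightHom t * g⁻¹ ∈ H ∧
      (g * upperRightHom t * g⁻¹) 1 0 = 1 := by
  let u1 : H := ⟨_, h1⟩
  obtain ⟨y, hy⟩ : ∃ y : H, y = g * u1 * g⁻¹ := ⟨_, rfl⟩
  have hyv : (y : GL (Fin 2) K) = (g : GL (Fin 2) K) * upperRightHom 1 * (g : GL (Fin 2) K)⁻¹ := by
    rw [hy]; rfl
  obtain ⟨c1, c2, c3, c4⟩ := conj_entries (g : GL (Fin 2) K) 1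
  rw [← hyv] at c1 c2 c3 c4
  have hd := (g : GL (Fin 2) K).det_ne_zero
  have ytr : (y : GL (Fin 2) K) 0 0 + (y : GL (Fin 2) K) 1 1 = 2 := by rw [c2, c3]; ring
  have ydet : (y : GL (Fin 2) K).val.det = 1 := by rw [hyv]; simp [hd]
  obtain ⟨c, hc⟩ : ∃ c, c = (y : GL (Fin 2) K) 1 0 := ⟨_, rfl⟩
  have hc0 : c ≠ 0 := by
    rw [hc, c1]; simp [hg, hd]
  obtain ⟨w, hw⟩ : ∃ w : H, w = u1 * y := ⟨_, rfl⟩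
  have hwv : (w : GL (Fin 2) K) = upperRightHom 1 * (y : GL (Fin 2) K) := by
    rw [hw]; rfl
  have w10 : (w : GL (Fin 2) K) 1 0 = c := by
    rw [hwv, hc]; simp [Matrix.mul_apply]
  have wtr : (w : GL (Fin 2) K) 0 0 + (w : GL (Fin 2) K) 1 1 = 2 + c := by
    rw [hwv, hc, ← ytr]; simp [Matrix.mul_apply]; ring
  have wdet : (w : GL (Fin 2) K).val.det = 1 := by
    rw [hwv, coe_mul, det_mul, ydet]; simp
  have wdet' := wdet
  rw [det_fin_two] at wdet'
  have wZ : w ∉ scSub H := fun h => hc0 (by rw [← w10]; exact h.1)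
  have hfix : ∃ x : OnePoint K, w • x = x := by
    by_cases hP : (w : GL (Fin 2) K).IsParabolic
    · obtain ⟨x, hx⟩ := fixed_one _ hP
      have : x ∈ fixedBy (OnePoint K) (w : GL (Fin 2) K) := by rw [hx]; rfl
      exact ⟨x, this⟩
    · have h2 := fixed_two _ hP wZ
      have : (fixedBy (OnePoint K) (w : GL (Fin 2) K)).Nonempty := by
        rw [Set.nonempty_iff_ne_empty]
        intro h
        rw [h] at h2; simp at h2
      obtain ⟨x, hx⟩ := this
      exact ⟨x, hx⟩
  obtain ⟨x, hx⟩ := hfix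
  have key : c ^ 8 = 1 := by
    by_cases hxo : x ∈ orbit H (∞ : OnePoint K)
    · obtain ⟨h, rfl⟩ := hxo
      have hv : (h⁻¹ * w * h) • (∞ : OnePoint K) = ∞ := by
        rw [mul_smul, mul_smul, inv_smul_eq_iff]; exact hx
      obtain ⟨v, hvd⟩ : ∃ v : H, v = h⁻¹ * w * h := ⟨_, rfl⟩
      rw [← hvd] at hv
      have v10 : (v : GL (Fin 2) K) 1 0 = 0 := smul_infty_eq_self_iff.1 hv
      have hch : (⟨chi H ⟨v, hv⟩, ⟨_, rfl⟩⟩ : (chi H).range) ^ 2 = 1 := by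
        have h4 := pow_card_eq_one' (x := (⟨chi H ⟨v, hv⟩, ⟨_, rfl⟩⟩ : (chi H).range))
        rwa [hk] at h4
      have hch2 : (chi H ⟨v, hv⟩ : K) ^ 2 = 1 :=
        congrArg (fun x : (chi H).range => (x.1 : K)) hch
      rw [chi_apply] at hch2
      have hvv : (v : GL (Fin 2) K).val = (h : GL (Fin 2) K).val⁻¹ * (w : GL (Fin 2) K).val *
          (h : GL (Fin 2) K).val := by
        rw [hvd]; simp
      have hdh : IsUnit (h : GL (Fin 2) K).val.det := (h : GL (Fin 2) K).det_ne_zero.isUnit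
      have vdet : (v : GL (Fin 2) K).val.det = 1 := by
        rw [hvd]; simp [wdet, (h : GL (Fin 2) K).det_ne_zero]
      have vtr : (v : GL (Fin 2) K).val.trace = 2 + c := by
        rw [← wtr, ← Matrix.trace_fin_two, hvv, Matrix.trace_mul_comm, ← mul_assoc,
          Matrix.mul_nonsing_inv _ hdh, one_mul]
      rw [Matrix.trace_fin_two] at vtr
      rw [det_fin_two, v10] at vdet
      have v11 : (v : GL (Fin 2) K) 1 1 ≠ 0 := by
        intro h4; rw [h4] at vdet; simp at vdet
      have hch3 : (v : GL (Fin 2) K) 0 0 ^ 2 = (v : GL (Fin 2) K) 1 1 ^ 2 := by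
        have hch4 : ((v : GL (Fin 2) K) 0 0 / (v : GL (Fin 2) K) 1 1) ^ 2 = 1 := hch2
        rwa [div_pow, div_eq_one_iff_eq (pow_ne_zero 2 v11)] at hch4
      have hc2 : c ^ 2 = 1 := by
        rcases sq_eq_sq_iff_eq_or_eq_neg.1 hch3 with h5 | h5
        · rw [h5] at vtr vdet
          have : c * (c + 1) = 0 := by
            linear_combination (-2 - c - 2 * (v : GL (Fin 2) K) 1 1) * vtr + 4 * vdet - c * h3
          have : c = -1 := by
            rcases mul_eq_zero.1 this with h | h
            · exact absurd h hc0
            · linear_combination h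
          rw [this]; ring
        · rw [h5] at vtr
          have : c = 1 := by linear_combination - vtr - h3
          rw [this]; ring
      linear_combination (c ^ 6 + c ^ 4 + c ^ 2 + 1) * hc2
    · have hcard := hst x hxo ⟨w, wZ, hx⟩
      have hle : scSub H ≤ stabilizer H x := fun s hs => IsSc.smul hs x
      have hnorm : (scSub H).Normal := by
        constructor
        rintro n hn g
        have : g * n * g⁻¹ = n := by
          rw [mul_inv_eq_iff_eq_mul]
          apply Subtype.ext
          apply Units.ext
          obtain ⟨h1, h2, h3⟩ := hn
          ext i j
          fin_cases i <;> fin_cases j <;> simp [Matrix.mul_apply, h1, h2, h3, mul_comm]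
        rw [this]; exact hn
      have hidx : ((scSub H).subgroupOf (stabilizer H x)).index = 5 := by
        have h6 := Subgroup.card_mul_index ((scSub H).subgroupOf (stabilizer H x))
        rw [hcard, Nat.card_congr (Subgroup.subgroupOfEquivOfLe hle).toEquiv, mul_comm 5] at h6
        exact Nat.eq_of_mul_eq_mul_left Nat.card_pos h6
      have h7 := Subgroup.pow_index_mem ((scSub H).subgroupOf (stabilizer H x)) ⟨w, hx⟩
      rw [hidx] at h7
      have h8 : w ^ 5 ∈ scSub H := h7
      have h9 : ((w : GL (Fin 2) K).val ^ 5) 1 0 = 0 := h8.1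
      rw [pow5, wtr, wdet', w10] at h9
      have h10 := (mul_eq_zero.1 h9).resolve_left hc0
      obtain ⟨t, ht⟩ : ∃ t, t = 2 + c := ⟨_, rfl⟩
      have hct : c = t - 2 := by rw [ht]; ring
      rw [← ht] at h10
      rw [hct]
      linear_combination (1464 - 496 * t + 115 * t ^ 2 - 16 * t ^ 3 + t ^ 4) * h10 +
        (-403 - 176 * t + 2023 * t ^ 2 - 1088 * t ^ 3) * h3
  obtain ⟨y1, hy1, d1, e1, -⟩ := sq_step H h1 y y.2 ydet
  obtain ⟨y2, hy2, d2, e2, -⟩ := sq_step H h1 y1 hy1 d1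
  obtain ⟨y3, hy3, d3, e3, h, hh⟩ := sq_step H h1 y2 hy2 d2
  have e4 : y3 1 0 = -1 := by
    rw [e3, e2, e1, ← hc]; linear_combination - key
  refine ⟨h, -1, ?_, ?_⟩
  · have : h * upperRightHom (-1) * h⁻¹ = y3⁻¹ := by
      rw [hh, AddChar.map_neg_eq_inv]; group
    rw [this]; exact H.inv_mem hy3
  · rw [hh, (conj_entries h 1).1] at e4
    rw [(conj_entries h (-1)).1]
    linear_combination - e4
end

section
open Matrix.GeneralLinearGroup OnePoint

variable {K : Type*} [Field K] [DecidableEq K]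

theorem coreThm (p : ℕ) [Fact p.Prime] (hp : Odd p) [CharP K p] [IsAlgClosed K]
    (H : Subgroup (GL (Fin 2) K)) [Finite H]
    (h1 : upperRightHom (1 : K) ∈ H) (g : H) (hg : (g : GL (Fin 2) K) 1 0 ≠ 0) :
    ∃ g : GL (Fin 2) K, ∃ t, g * upperRightHom t * g⁻¹ ∈ H ∧
      (g * upperRightHom t * g⁻¹) 1 0 = 1 := by
  have hpp : p.Prime := Fact.out
  have h2 : NeZero (2 : K) := by
    constructor
    intro h
    have h' : ((2 : ℕ) : K) = 0 := by exact_mod_cast h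
    have h3 := (CharP.cast_eq_zero_iff K p 2).1 h'
    rw [Nat.prime_dvd_prime_iff_eq hpp Nat.prime_two] at h3
    rw [h3] at hp
    exact absurd hp (by decide)
  have hpU : p ∣ Nat.card (uSub H) := by
    let u1 : uSub H := ⟨⟨_, h1⟩, (mem_uSub H _).2 ⟨1, rfl⟩⟩
    have : orderOf u1 = p := by
      apply orderOf_eq_prime
      · apply Subtype.ext
        apply Subtype.ext
        show (upperRightHom (1 : K)) ^ p = 1
        rw [← AddChar.map_nsmul_eq_pow]
        simp
      · intro h
        have h3 : upperRightHom (1 : K) = 1 :=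
          congrArg (fun x : uSub H => (x.1 : GL (Fin 2) K)) h
        have h4 := congrArg (fun x : GL (Fin 2) K => x 0 1) h3
        simp at h4
    rw [← this]
    exact orderOf_dvd_natCard u1
  have hp3 : 3 ≤ p := by
    have := hpp.two_le
    rcases hp with ⟨k, hk⟩
    omega
  refine (mainCount p (scSub H) {g : H | (g : GL (Fin 2) K).IsParabolic} (∞ : OnePoint K) (uSub H)
    ?_ ?_ ?_ ?_ ?_ ?_ ?_ ?_ ?_ (cardC p H) (Nat.card (chi H).range) (cardStab p H) (cardRange H h1) ?_).elim
    (fun h => trans_case H h1 g hg h) ?_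
  · rintro g hg hs
    have hg' : (g : GL (Fin 2) K).IsParabolic := hg
    exact hg'.1 ((isSc_iff _).1 hs)
  · rintro g hg x
    exact IsSc.smul hg x
  · rintro g hg
    exact fixed_one _ hg
  · rintro g hP hS
    exact fixed_two _ hP hS
  · rintro g h hg
    exact (Matrix.GeneralLinearGroup.isParabolic_conj_iff _ _).2 hg
  · rintro g hg
    obtain ⟨k, hk, hk'⟩ := parab_pow p (g : GL (Fin 2) K)
      (MonoidHom.isOfFinOrder H.subtype (isOfFinOrder_of_finite g)) hg
    refine ⟨g ^ k, hk, Subtype.ext hk', ?_⟩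
    intro x hx
    exact (stabilizer H x).pow_mem hx k
  · rintro u hu
    obtain ⟨t, ht⟩ := (mem_uSub H u).1 hu
    refine smul_infty_eq_self_iff.2 ?_
    rw [← ht]; simp
  · rintro u hu hu1
    obtain ⟨t, ht⟩ := (mem_uSub H u).1 hu
    show (u : GL (Fin 2) K).IsParabolic
    rw [← ht]
    apply u_parab
    rintro rfl
    apply hu1
    apply Subtype.ext
    rw [← ht]; exact AddChar.map_zero_eq_one _
  · exact hp3.trans (Nat.le_of_dvd Nat.card_pos hpU)
  · exact ⟨g, fun h => hg (smul_infty_eq_self_iff.1 h)⟩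
  · rintro ⟨h, hA, hB⟩
    have : p = 3 := by
      rw [h, Nat.prime_dvd_prime_iff_eq hpp Nat.prime_three] at hpU
      exact hpU
    have h3 : (3 : K) = 0 := by
      have := CharP.cast_eq_zero K p
      subst p
      exact_mod_cast this
    exact exc_case H h3 h1 g hg hA hB

/-- upper elementary matrix -/
def uS (p : ℕ) (x : ZMod p) : Matrix.SpecialLinearGroup (Fin 2) (ZMod p) :=
  ⟨!![1, x; 0, 1], by simp [det_fin_two]⟩

/-- lower elementary matrix -/
def lS (p : ℕ) (x : ZMod p) : Matrix.SpecialLinearGroup (Fin 2) (ZMod p) :=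
  ⟨!![1, 0; x, 1], by simp [det_fin_two]⟩

lemma uS_coe (p : ℕ) (x : ZMod p) : (uS p x : Matrix (Fin 2) (Fin 2) (ZMod p)) = !![1, x; 0, 1] := rfl
lemma lS_coe (p : ℕ) (x : ZMod p) : (lS p x : Matrix (Fin 2) (Fin 2) (ZMod p)) = !![1, 0; x, 1] := rfl

/-- generation of `SL₂(𝔽ₚ)` -/
lemma sl_gen (p : ℕ) [Fact p.Prime] (S : Subgroup (Matrix.SpecialLinearGroup (Fin 2) (ZMod p)))
    (hu : uS p 1 ∈ S) (hl : lS p 1 ∈ S)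
    (A : Matrix.SpecialLinearGroup (Fin 2) (ZMod p)) : A ∈ S := by
  have hun : ∀ n : ℕ, uS p n ∈ S := by
    intro n
    induction n with
    | zero =>
      have : uS p ((0 : ℕ) : ZMod p) = 1 := by
        ext i j
        rw [uS_coe, Matrix.SpecialLinearGroup.coe_one]
        fin_cases i <;> fin_cases j <;> simp
      rw [this]; exact S.one_mem
    | succ n ih =>
      have : uS p ((n + 1 : ℕ) : ZMod p) = uS p n * uS p 1 := by
        ext i j
        rw [Matrix.SpecialLinearGroup.coe_mul, uS_coe, uS_coe, uS_coe]
        fin_cases i <;> fin_cases j <;> simp [add_comm]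
      rw [this]; exact S.mul_mem ih hu
  have hln : ∀ n : ℕ, lS p n ∈ S := by
    intro n
    induction n with
    | zero =>
      have : lS p ((0 : ℕ) : ZMod p) = 1 := by
        ext i j
        rw [lS_coe, Matrix.SpecialLinearGroup.coe_one]
        fin_cases i <;> fin_cases j <;> simp
      rw [this]; exact S.one_mem
    | succ n ih =>
      have : lS p ((n + 1 : ℕ) : ZMod p) = lS p n * lS p 1 := by
        ext i j
        rw [Matrix.SpecialLinearGroup.coe_mul, lS_coe, lS_coe, lS_coe]
        fin_cases i <;> fin_cases j <;> simp
      rw [this]; exact S.mul_mem ih hl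
  have hua : ∀ x : ZMod p, uS p x ∈ S := by
    intro x
    have := hun x.val
    rwa [ZMod.natCast_zmod_val] at this
  have hla : ∀ x : ZMod p, lS p x ∈ S := by
    intro x
    have := hln x.val
    rwa [ZMod.natCast_zmod_val] at this
  have hA : ∀ A : Matrix.SpecialLinearGroup (Fin 2) (ZMod p), A 1 0 ≠ 0 → A ∈ S := by
    intro A hc
    have hd := A.det_coe
    rw [det_fin_two] at hd
    have : A = uS p ((A 0 0 - 1) / A 1 0) * lS p (A 1 0) *
        uS p ((A 1 1 - 1) / A 1 0) := by
      ext i j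
      rw [Matrix.SpecialLinearGroup.coe_mul, Matrix.SpecialLinearGroup.coe_mul, uS_coe, uS_coe, lS_coe]
      fin_cases i <;> fin_cases j <;> simp [Matrix.mul_apply] <;> field_simp
      · ring
      · linear_combination - hd
      · ring
    rw [this]
    exact S.mul_mem (S.mul_mem (hua _) (hla _)) (hua _)
  by_cases hc : A 1 0 = 0
  · have hd := A.det_coe
    rw [det_fin_two, hc] at hd
    have h3 := hA (lS p 1 * A) (by
      rw [Matrix.SpecialLinearGroup.coe_mul, lS_coe]
      intro h
      have h4 : A 0 0 = 0 := by simpa [Matrix.mul_apply, hc] using h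
      rw [h4] at hd
      simp at hd)
    exact (S.mul_mem_cancel_left hl).1 h3
  · exact hA A hc

lemma gen_conj (p : ℕ) [Fact p.Prime] [Algebra (ZMod p) K] (H : Subgroup (GL (Fin 2) K))
    (h1 : upperRightHom (1 : K) ∈ H) (h : GL (Fin 2) K) (t : K)
    (hy : h * upperRightHom t * h⁻¹ ∈ H) (hy1 : (h * upperRightHom t * h⁻¹) 1 0 = 1) :
    ∃ g : GL (Fin 2) K, ∀ A : Matrix.SpecialLinearGroup (Fin 2) (ZMod p),
      g * (Matrix.SpecialLinearGroup.map (algebraMap (ZMod p) K) A).toGL * g⁻¹ ∈ H := by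
  obtain ⟨c1, c2, c3, c4⟩ := conj_entries h t
  have hd := h.det_ne_zero
  have cdet : (h * upperRightHom t * h⁻¹).val.det = 1 := by simp [hd]
  generalize h * upperRightHom t * h⁻¹ = y at *
  have ytr : y 0 0 + y 1 1 = 2 := by rw [c2, c3]; ring
  rw [det_fin_two, hy1] at cdet
  obtain ⟨e, he⟩ : ∃ e, e = y 0 0 - 1 := ⟨_, rfl⟩
  refine ⟨upperRightHom e, ?_⟩
  let f : Matrix.SpecialLinearGroup (Fin 2) (ZMod p) →* GL (Fin 2) K :=
    (MulAut.conj (upperRightHom e)).toMonoidHom.comp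
      (Matrix.SpecialLinearGroup.toGL.comp (Matrix.SpecialLinearGroup.map (algebraMap (ZMod p) K)))
  apply sl_gen p (H.comap f)
  · rw [Subgroup.mem_comap]
    convert h1
    show upperRightHom e * _ * (upperRightHom e)⁻¹ = _
    rw [mul_inv_eq_iff_eq_mul]
    apply Units.ext
    ext i j
    fin_cases i <;> fin_cases j <;> simp [Matrix.mul_apply, uS_coe, add_comm]
  · rw [Subgroup.mem_comap]
    convert hy
    show upperRightHom e * _ * (upperRightHom e)⁻¹ = _
    rw [mul_inv_eq_iff_eq_mul]
    apply Units.ext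
    ext i j
    fin_cases i <;> fin_cases j <;> simp [Matrix.mul_apply, lS_coe, hy1]
    · rw [he]; ring
    · rw [he]; linear_combination (-y 0 0) * ytr + cdet
    · rw [he]; linear_combination - ytr

lemma conj_unip (h : GL (Fin 2) K) (e f g : K) (hh : h.val = !![1 + e, f; g, 1 - e])
    (hd : e ^ 2 + f * g = 0) (h0 : h ≠ 1) :
    ∃ g0 : GL (Fin 2) K, g0 * upperRightHom 1 * g0⁻¹ = h := by
  by_cases hg : g = 0
  · have he : e = 0 := by
      rw [hg] at hd
      simpa using hd
    subst hg he
    have hf : f ≠ 0 := by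
      rintro rfl
      apply h0
      apply Units.ext
      rw [hh]
      ext i j
      fin_cases i <;> fin_cases j <;> simp
    refine ⟨GeneralLinearGroup.mkOfDetNeZero !![f, 0; 0, 1] (by simp [det_fin_two, hf]), ?_⟩
    rw [mul_inv_eq_iff_eq_mul]
    apply Units.ext
    rw [Units.val_mul, Units.val_mul, hh]
    ext i j
    fin_cases i <;> fin_cases j <;> simp [GeneralLinearGroup.mkOfDetNeZero, Matrix.mul_apply]
  · refine ⟨GeneralLinearGroup.mkOfDetNeZero !![e, 1; g, 0] (by simp [det_fin_two, hg]), ?_⟩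
    rw [mul_inv_eq_iff_eq_mul]
    apply Units.ext
    rw [Units.val_mul, Units.val_mul, hh]
    ext i j
    fin_cases i <;> fin_cases j <;> simp [GeneralLinearGroup.mkOfDetNeZero, Matrix.mul_apply]
    · linear_combination - hd
    · ring
    · ring

lemma exists_conj (p : ℕ) [Fact p.Prime] [CharP K p] (h : GL (Fin 2) K) (hh : orderOf h = p) :
    ∃ g0 : GL (Fin 2) K, g0 * upperRightHom 1 * g0⁻¹ = h := by
  have hpp : p.Prime := Fact.out
  have hpow : (h.val - 1) ^ p = 0 := by
    rw [sub_pow_char_of_commute p (Commute.one_right _), one_pow, ← Units.val_pow_eq_pow_val,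
      ← hh, pow_orderOf_eq_one]
    simp
  have hn : IsNilpotent (h.val - 1) := ⟨p, hpow⟩
  have htr : (h.val - 1).trace = 0 := (Matrix.isNilpotent_trace_of_isNilpotent hn).eq_zero
  have hdet : (h.val - 1).det = 0 := by
    have := congrArg Matrix.det hpow
    rw [det_pow] at this
    rw [Matrix.det_zero] at this
    exact pow_eq_zero_iff hpp.ne_zero |>.1 this
  rw [Matrix.trace_fin_two] at htr
  rw [det_fin_two] at hdet
  simp at htr hdet
  refine conj_unip h (h 0 0 - 1) (h 0 1) (h 1 0) ?_ ?_ ?_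
  · ext i j
    fin_cases i <;> fin_cases j <;> simp
    linear_combination htr
  · linear_combination (h 0 0 - 1) * htr - hdet
  · rintro rfl
    rw [orderOf_one] at hh
    exact hpp.one_lt.ne hh

lemma exists_low (H : Subgroup (GL (Fin 2) K)) (g0 : GL (Fin 2) K)
    (hirr : ∀ W : Submodule K (Fin 2 → K),
      (∀ g ∈ H, ∀ x ∈ W, (g : Matrix (Fin 2) (Fin 2) K) *ᵥ x ∈ W) → W = ⊥ ∨ W = ⊤) :
    ∃ x : GL (Fin 2) K, g0 * x * g0⁻¹ ∈ H ∧ x 1 0 ≠ 0 := by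
  by_contra! hcon
  have hW := hirr (Submodule.span K {g0.val *ᵥ ![1, 0]}) (by
    intro g hg x hx
    obtain ⟨a, rfl⟩ := Submodule.mem_span_singleton.1 hx
    have h1 := hcon (g0⁻¹ * g * g0) (by
      have : g0 * (g0⁻¹ * g * g0) * g0⁻¹ = g := by group
      rw [this]; exact hg)
    have h2 : g.val * g0.val = g0.val * (g0⁻¹ * g * g0).val := by
      rw [← Units.val_mul, ← Units.val_mul]
      congr 1
      group
    have h3 : (g0⁻¹ * g * g0).val *ᵥ ![1, 0] = ((g0⁻¹ * g * g0) 0 0) • ![1, 0] := by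
      ext i
      fin_cases i
      · simp only [Matrix.mulVec, dotProduct, Fin.sum_univ_two]
        simp
      · simp only [Matrix.mulVec, dotProduct, Fin.sum_univ_two]
        simpa using h1
    rw [Matrix.mulVec_smul, Matrix.mulVec_mulVec, h2, ← Matrix.mulVec_mulVec, h3,
      Matrix.mulVec_smul]
    exact Submodule.smul_mem _ _ (Submodule.smul_mem _ _ (Submodule.mem_span_singleton_self _)))
  rcases hW with h | h
  · rw [Submodule.span_singleton_eq_bot] at h
    have h4 := congrArg (fun v => (g0⁻¹).val *ᵥ v) h
    simp only [Matrix.mulVec_mulVec, Matrix.mulVec_zero] at h4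
    rw [← Units.val_mul, inv_mul_cancel] at h4
    have := congrFun h4 0
    simp at this
  · have h5 := finrank_span_le_card (R := K) ({g0.val *ᵥ ![1, 0]} : Set (Fin 2 → K))
    rw [h, finrank_top] at h5
    simp at h5

theorem mainK (p : ℕ) [Fact p.Prime] (hp : Odd p) [CharP K p] [IsAlgClosed K] [Algebra (ZMod p) K]
    (H : Subgroup (GL (Fin 2) K)) [Finite H]
    (hirr : ∀ W : Submodule K (Fin 2 → K),
      (∀ g ∈ H, ∀ x ∈ W, (g : Matrix (Fin 2) (Fin 2) K) *ᵥ x ∈ W) → W = ⊥ ∨ W = ⊤)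
    (hdvd : p ∣ Nat.card H) :
    ∃ g : GL (Fin 2) K, ∀ A : Matrix.SpecialLinearGroup (Fin 2) (ZMod p),
      g * (Matrix.SpecialLinearGroup.map (algebraMap (ZMod p) K) A).toGL * g⁻¹ ∈ H := by
  obtain ⟨x, hx⟩ := exists_prime_orderOf_dvd_card' p hdvd
  rw [← Subgroup.orderOf_coe] at hx
  obtain ⟨g0, hg0⟩ := exists_conj p _ hx
  obtain ⟨z, hz, hz0⟩ := exists_low H g0 hirr
  let H' : Subgroup (GL (Fin 2) K) := H.comap (MulAut.conj g0).toMonoidHom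
  have hH' : ∀ w, w ∈ H' ↔ g0 * w * g0⁻¹ ∈ H := fun w => Iff.rfl
  have hfin : Finite H' := by
    refine Finite.of_injective (fun w : H' => (⟨_, w.2⟩ : H)) ?_
    intro a b hab
    have h4 := congrArg Subtype.val hab
    exact Subtype.ext ((MulAut.conj g0).injective h4)
  have h1 : upperRightHom (1 : K) ∈ H' := by
    rw [hH', hg0]; exact x.2
  obtain ⟨h, t, hy, hy1⟩ := coreThm p hp H' h1 ⟨z, hz⟩ hz0
  obtain ⟨k, hk⟩ := gen_conj p H' h1 h t hy hy1
  refine ⟨g0 * k, fun A => ?_⟩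
  have h5 := (hH' _).1 (hk A)
  convert h5 using 1
  group
end
end

/-- If `p` is an odd prime and `H` is a finite subgroup of `GL₂(F̄ₚ)` acting
(absolutely) irreducibly on `F̄ₚ²` whose order is divisible by `p`, then `H` contains a
conjugate of `SL₂(𝔽ₚ)`; in particular `-1 ∈ H`. -/
theorem stmt0 (p : ℕ) [Fact p.Prime] (hp : Odd p)
    (H : Subgroup (GL (Fin 2) (AlgebraicClosure (ZMod p)))) [Finite H]
    (hirr : ∀ W : Submodule (AlgebraicClosure (ZMod p)) (Fin 2 → AlgebraicClosure (ZMod p)),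
      (∀ g ∈ H, ∀ x ∈ W,
        (g : Matrix (Fin 2) (Fin 2) (AlgebraicClosure (ZMod p))) *ᵥ x ∈ W) →
      W = ⊥ ∨ W = ⊤)
    (hdvd : p ∣ Nat.card H) :
    (∃ g : GL (Fin 2) (AlgebraicClosure (ZMod p)),
      ∀ A : Matrix.SpecialLinearGroup (Fin 2) (ZMod p),
        g * (Matrix.SpecialLinearGroup.map
            (algebraMap (ZMod p) (AlgebraicClosure (ZMod p))) A).toGL * g⁻¹ ∈ H) ∧
    (-1 : GL (Fin 2) (AlgebraicClosure (ZMod p))) ∈ H := by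
  classical
  have hch : CharP (AlgebraicClosure (ZMod p)) p :=
    charP_of_injective_algebraMap (algebraMap (ZMod p) (AlgebraicClosure (ZMod p))).injective p
  obtain ⟨g, hg⟩ := mainK p hp H hirr hdvd
  refine ⟨⟨g, hg⟩, ?_⟩
  have h1 := hg (-1)
  convert h1 using 1
  rw [eq_mul_inv_iff_mul_eq]
  apply Units.ext
  ext i j
  fin_cases i <;> fin_cases j <;> simp [Matrix.mul_apply]
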